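/- There exists a constant ĉ₂ > 0, depending only on p, c₁, c̃₁, c₂, with the following property: for every ξ ∈ Sym_d and every V ∈ L^p(Y; Sym_d) with ∫_Y V(y) dy = 0 and ∫_Y S(y, ξ + V(y)) : V(y) dy = 0, the homogenized stress Ŝ(ξ) := ∫_Y S(y, ξ + V(y)) dy satisfies the growth bound |Ŝ(ξ)|^{p'} ≤ ĉ₂ (|ξ|^p + 1). -/

import Mathlib

open MeasureTheory Filter Set Matrix

noncomputable section

/-- The unit cell `Y = (0,1]^d`. -/
def Ycell (d : ℕ) : Set (EuclideanSpace ℝ (Fin d)) :=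
  {y | ∀ i, y i ∈ Set.Ioc (0 : ℝ) 1}

/-- Frobenius inner product `A : B = Σ_{ij} a_{ij} b_{ij}` on `d×d` matrices. -/
def mdot {d : ℕ} (A B : Matrix (Fin d) (Fin d) ℝ) : ℝ :=
  ∑ i, ∑ j, A i j * B i j

/-- The Frobenius norm `|A| = √(A : A)`. -/
def mnorm {d : ℕ} (A : Matrix (Fin d) (Fin d) ℝ) : ℝ :=
  Real.sqrt (mdot A A)


def mvec {d : ℕ} (A : Matrix (Fin d) (Fin d) ℝ) : EuclideanSpace ℝ (Fin d × Fin d) :=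
  WithLp.toLp 2 (fun ij => A ij.1 ij.2)

lemma mdot_eq_inner {d : ℕ} (A B : Matrix (Fin d) (Fin d) ℝ) :
    mdot A B = inner ℝ (mvec A) (mvec B) := by
  simp [mdot, mvec, PiLp.inner_apply, Fintype.sum_prod_type, mul_comm]

lemma mnorm_eq_norm {d : ℕ} (A : Matrix (Fin d) (Fin d) ℝ) : mnorm A = ‖mvec A‖ := by
  rw [mnorm, mdot_eq_inner, real_inner_self_eq_norm_sq, Real.sqrt_sq (norm_nonneg _)]

lemma mnorm_nonneg {d : ℕ} (A : Matrix (Fin d) (Fin d) ℝ) : 0 ≤ mnorm A :=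
  Real.sqrt_nonneg _

lemma mnorm_add {d : ℕ} (A B : Matrix (Fin d) (Fin d) ℝ) :
    mnorm (A + B) ≤ mnorm A + mnorm B := by
  rw [mnorm_eq_norm, mnorm_eq_norm, mnorm_eq_norm]
  exact norm_add_le (mvec A) (mvec B)

lemma mdot_abs {d : ℕ} (A B : Matrix (Fin d) (Fin d) ℝ) :
    |mdot A B| ≤ mnorm A * mnorm B := by
  rw [mdot_eq_inner, mnorm_eq_norm, mnorm_eq_norm]
  exact abs_real_inner_le_norm _ _

lemma mdot_add {d : ℕ} (A B C : Matrix (Fin d) (Fin d) ℝ) :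
    mdot A (B + C) = mdot A B + mdot A C := by
  simp [mdot, mul_add, Finset.sum_add_distrib]

lemma abs_entry {d : ℕ} (A : Matrix (Fin d) (Fin d) ℝ) (i j : Fin d) :
    |A i j| ≤ mnorm A := by
  rw [mnorm_eq_norm]
  exact PiLp.norm_apply_le (mvec A) (i, j)

lemma mdot_self {d : ℕ} (A : Matrix (Fin d) (Fin d) ℝ) : mdot A A = mnorm A ^ 2 := by
  rw [mnorm_eq_norm, mdot_eq_inner, real_inner_self_eq_norm_sq]

lemma Ycell_meas (d : ℕ) : MeasurableSet (Ycell d) := by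
  have : Ycell d = ⋂ i, (fun y : EuclideanSpace ℝ (Fin d) => y i) ⁻¹' Set.Ioc 0 1 := by
    ext y; simp [Ycell]
  rw [this]
  exact MeasurableSet.iInter fun i => measurableSet_Ioc.preimage (by fun_prop)

lemma Ycell_vol (d : ℕ) : volume (Ycell d) = 1 := by
  have h := EuclideanSpace.volume_preserving_symm_measurableEquiv_toLp (Fin d)
  have e : Ycell d = (MeasurableEquiv.toLp 2 (Fin d → ℝ)).symm ⁻¹'
      (Set.pi Set.univ fun _ => Set.Ioc (0:ℝ) 1) := by
    ext y; simp only [Ycell, Set.mem_ofPred_eq, Set.mem_preimage, Set.mem_pi, Set.mem_univ,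
      true_implies]; rfl
  rw [e, h.measure_preimage_equiv, Real.volume_pi_Ioc]
  simp

lemma young_eps {p p' : ℝ} (h : p'.HolderConjugate p) (ε : ℝ) (hε : 0 < ε) :
    ∃ K : ℝ, 0 < K ∧ ∀ a b : ℝ, 0 ≤ a → 0 ≤ b → a * b ≤ ε * a ^ p' + K * b ^ p := by
  have hp' := h.pos
  have hp := h.symm.pos
  set t := (p' * ε) ^ (1 / p') with ht
  have tpos : 0 < t := by positivity
  have tp : t ^ p' = p' * ε := by
    rw [ht, ← Real.rpow_mul (by positivity), one_div_mul_cancel hp'.ne', Real.rpow_one]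
  refine ⟨t⁻¹ ^ p / p, by positivity, fun a b ha hb => ?_⟩
  have y := Real.young_inequality_of_nonneg (a := t * a) (b := t⁻¹ * b)
    (by positivity) (by positivity) h
  rw [Real.mul_rpow tpos.le ha, Real.mul_rpow (by positivity) hb, tp] at y
  calc a * b = t * a * (t⁻¹ * b) := by field_simp
    _ ≤ _ := y
    _ = _ := by field_simp

lemma super_meas {d : ℕ} (S : EuclideanSpace ℝ (Fin d) → Matrix (Fin d) (Fin d) ℝ →
            Matrix (Fin d) (Fin d) ℝ)
    (h1 : ∀ (ξ : Matrix (Fin d) (Fin d) ℝ) (i j : Fin d), Measurable fun y => S y ξ i j)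
    (h2 : ∀ᵐ y : EuclideanSpace ℝ (Fin d), ∀ i j : Fin d, Continuous fun ξ => S y ξ i j)
    (W : EuclideanSpace ℝ (Fin d) → Matrix (Fin d) (Fin d) ℝ)
    (hW : ∀ i j : Fin d, Measurable fun y => W y i j) (i j : Fin d) :
    AEMeasurable (fun y => S y (W y) i j) := by
  classical
  set N := toMeasurable volume {y | ¬ ∀ i j : Fin d, Continuous fun ξ => S y ξ i j} with hN
  have hN0 : volume N = 0 := by rw [hN, measure_toMeasurable]; exact h2
  have hNm : MeasurableSet N := measurableSet_toMeasurable _ _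
  let u : (Fin d → Fin d → ℝ) → EuclideanSpace ℝ (Fin d) → ℝ :=
    fun ξ y => if y ∈ N then 0 else S y ξ i j
  have hu : Measurable (Function.uncurry u) := by
    apply measurable_uncurry_of_continuous_of_measurable
    · intro y
      by_cases hy : y ∈ N
      · simp only [u, hy, if_true]; exact continuous_const
      · simp only [u, hy, if_false]
        have : ∀ i j : Fin d, Continuous fun ξ => S y ξ i j := by
          by_contra hc
          exact hy (subset_toMeasurable _ _ hc)
        exact this i j
    · intro ξ
      exact Measurable.ite hNm measurable_const (h1 ξ i j)
  have hWm : Measurable (fun y => ((fun i j => W y i j : Fin d → Fin d → ℝ), y)) :=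
    (measurable_pi_lambda _ fun i => measurable_pi_lambda _ fun j => hW i j).prodMk measurable_id
  refine ⟨_, hu.comp hWm, ?_⟩
  have : ∀ᵐ y : EuclideanSpace ℝ (Fin d), y ∉ N := measure_eq_zero_iff_ae_notMem.1 hN0
  filter_upwards [this] with y hy
  simp only [Function.comp, Function.uncurry, u, hy, if_false]

/-- growth of the homogenized stress: there is a constant `ĉ₂ > 0`
depending only on `p, c₁, c̃₁, c₂` such that for every `ξ ∈ Sym_d` and every
`V ∈ L^p(Y; Sym_d)` with zero mean and `∫_Y S(y, ξ + V(y)) : V(y) dy = 0`, the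
homogenized stress `Ŝ(ξ) := ∫_Y S(y, ξ + V(y)) dy` satisfies
`|Ŝ(ξ)|^{p'} ≤ ĉ₂ (|ξ|^p + 1)`. -/
theorem stmt8 (p p' c₁ ct₁ c₂ : ℝ)
    (hp : 1 < p) (hp' : p' = p / (p - 1))
    (hc₁ : 0 < c₁) (hct₁ : 0 < ct₁) (hc₂ : 0 < c₂) :
    ∃ chat₂ : ℝ, 0 < chat₂ ∧
      ∀ (d : ℕ), 1 ≤ d →
      ∀ S : EuclideanSpace ℝ (Fin d) → Matrix (Fin d) (Fin d) ℝ →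
            Matrix (Fin d) (Fin d) ℝ,
      -- (S2) Carathéodory
      (∀ (ξ : Matrix (Fin d) (Fin d) ℝ) (i j : Fin d),
        Measurable fun y => S y ξ i j) →
      (∀ᵐ y : EuclideanSpace ℝ (Fin d), ∀ i j : Fin d,
        Continuous fun ξ => S y ξ i j) →
      -- (S3) strict monotonicity
      (∀ᵐ y : EuclideanSpace ℝ (Fin d), ∀ ξ₁ ξ₂ : Matrix (Fin d) (Fin d) ℝ,
        ξ₁ ≠ ξ₂ → 0 < mdot (S y ξ₁ - S y ξ₂) (ξ₁ - ξ₂)) →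
      -- (S4) coercivity and growth with the given constants
      (∀ (y : EuclideanSpace ℝ (Fin d)) (ξ : Matrix (Fin d) (Fin d) ℝ),
        c₁ * mnorm ξ ^ p - ct₁ ≤ mdot (S y ξ) ξ) →
      (∀ (y : EuclideanSpace ℝ (Fin d)) (ξ : Matrix (Fin d) (Fin d) ℝ),
        mnorm (S y ξ) ^ p' ≤ c₂ * (mnorm ξ ^ p + 1)) →
      ∀ ξ : Matrix (Fin d) (Fin d) ℝ, ξᵀ = ξ →
      ∀ V : EuclideanSpace ℝ (Fin d) → Matrix (Fin d) (Fin d) ℝ,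
        (∀ i j : Fin d, Measurable fun y => V y i j) →
        (∀ᵐ y ∂(volume.restrict (Ycell d)), (V y)ᵀ = V y) →
        IntegrableOn (fun y => mnorm (V y) ^ p) (Ycell d) →
        (∀ i j : Fin d, ∫ y in Ycell d, V y i j = 0) →
        (∫ y in Ycell d, mdot (S y (ξ + V y)) (V y)) = 0 →
        mnorm (Matrix.of fun i j => ∫ y in Ycell d, S y (ξ + V y) i j) ^ p' ≤
          chat₂ * (mnorm ξ ^ p + 1) := by
  have hconj : p'.HolderConjugate p := by
    rw [hp']; exact (Real.HolderConjugate.conjExponent hp).symm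
  have hp0 : 0 < p := by linarith
  have hp'0 : 0 < p' := hconj.pos
  have hp'1 : 1 < p' := hconj.lt
  obtain ⟨K, hK, hY⟩ := young_eps hconj (c₁ / (2 * c₂)) (by positivity)
  obtain ⟨K1, hK1, hY1⟩ := young_eps hconj 1 one_pos
  refine ⟨c₂ * ((2 / c₁) * (ct₁ + c₁ / 2 + K) + 1), by positivity, ?_⟩
  intro d hd S h1 h2 _ hco hgr ξ _ V hV _ hVp _ horth
  set μ := volume.restrict (Ycell d) with hμ
  have : IsProbabilityMeasure μ := ⟨by rw [hμ, Measure.restrict_apply_univ, Ycell_vol]⟩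
  have hWm : ∀ i j : Fin d, Measurable fun y => (ξ + V y) i j := fun i j =>
    (hV i j).const_add (ξ i j)
  have hsm : ∀ i j, AEMeasurable (fun y => S y (ξ + V y) i j) μ := fun i j =>
    (super_meas S h1 h2 _ hWm i j).restrict
  have hmn : ∀ F : EuclideanSpace ℝ (Fin d) → Matrix (Fin d) (Fin d) ℝ,
      (∀ i j, AEMeasurable (fun y => F y i j) μ) → AEMeasurable (fun y => mnorm (F y)) μ := by
    intro F hF
    unfold mnorm mdot
    refine AEMeasurable.sqrt ?_
    exact Finset.aemeasurable_fun_sum _ fun i _ => Finset.aemeasurable_fun_sum _ fun j _ =>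
      (hF i j).mul (hF i j)
  have hwn := hmn (fun y => ξ + V y) (fun i j => (hWm i j).aemeasurable)
  have hsn := hmn (fun y => S y (ξ + V y)) hsm
  have hvn := hmn V (fun i j => (hV i j).aemeasurable)
  -- integrability of |w|^p
  have hpE : ENNReal.ofReal p ≠ 0 := by simpa using hp0
  have iw : Integrable (fun y => mnorm (ξ + V y) ^ p) μ := by
    have hb : ∀ y, mnorm (ξ + V y) ^ p ≤ 2 ^ p * (mnorm ξ ^ p + mnorm (V y) ^ p) := by
      intro y
      have n1 := mnorm_nonneg ξ
      have n2 := mnorm_nonneg (V y)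
      have h3 : mnorm (ξ + V y) ≤ 2 * max (mnorm ξ) (mnorm (V y)) := by
        have := mnorm_add ξ (V y)
        have := le_max_left (mnorm ξ) (mnorm (V y))
        have := le_max_right (mnorm ξ) (mnorm (V y))
        linarith
      refine (Real.rpow_le_rpow (mnorm_nonneg _) h3 hp0.le).trans ?_
      rw [Real.mul_rpow (by norm_num) (n1.trans (le_max_left _ _))]
      gcongr
      have e1 : 0 ≤ mnorm ξ ^ p := by positivity
      have e2 : 0 ≤ mnorm (V y) ^ p := by positivity
      rcases max_cases (mnorm ξ) (mnorm (V y)) with h | h <;> rw [h.1] <;> linarith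
    refine Integrable.mono' (((integrable_const (mnorm ξ ^ p)).add hVp).const_mul (2 ^ p))
      (hwn.pow_const p).aestronglyMeasurable (Eventually.of_forall fun y => ?_)
    rw [Real.norm_of_nonneg (Real.rpow_nonneg (mnorm_nonneg _) _)]
    exact hb y
  have is' : Integrable (fun y => mnorm (S y (ξ + V y)) ^ p') μ := by
    refine Integrable.mono' ((iw.add (integrable_const 1)).const_mul c₂)
      (hsn.pow_const p').aestronglyMeasurable (Eventually.of_forall fun y => ?_)
    rw [Real.norm_of_nonneg (Real.rpow_nonneg (mnorm_nonneg _) _)]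
    exact hgr y _
  have is1 : Integrable (fun y => mnorm (S y (ξ + V y))) μ := by
    refine Integrable.mono' (is'.add (integrable_const K1))
      hsn.aestronglyMeasurable (Eventually.of_forall fun y => ?_)
    rw [Real.norm_of_nonneg (mnorm_nonneg _)]
    have := hY1 (mnorm (S y (ξ + V y))) 1 (mnorm_nonneg _) zero_le_one
    simpa using this
  have isij : ∀ i j, Integrable (fun y => S y (ξ + V y) i j) μ := fun i j =>
    Integrable.mono' is1 (hsm i j).aestronglyMeasurable
      (Eventually.of_forall fun y => abs_entry _ i j)
  have idot : ∀ B : Matrix (Fin d) (Fin d) ℝ, Integrable (fun y => mdot (S y (ξ + V y)) B) μ := by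
    intro B
    unfold mdot
    exact integrable_finsetSum _ fun i _ => integrable_finsetSum _ fun j _ =>
      (isij i j).mul_const _
  have isV : Integrable (fun y => mdot (S y (ξ + V y)) (V y)) μ := by
    refine Integrable.mono' (is'.add (hVp.const_mul K1)) ?_ (Eventually.of_forall fun y => ?_)
    · unfold mdot
      exact (Finset.aemeasurable_fun_sum _ fun i _ => Finset.aemeasurable_fun_sum _ fun j _ =>
        (hsm i j).mul (hV i j).aemeasurable).aestronglyMeasurable
    · have := hY1 (mnorm (S y (ξ + V y))) (mnorm (V y)) (mnorm_nonneg _) (mnorm_nonneg _)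
      rw [one_mul] at this
      exact (mdot_abs _ _).trans this
  -- a priori bound
  set X := ∫ y, mnorm (ξ + V y) ^ p ∂μ with hX
  have hX1 : c₁ * X - ct₁ ≤ c₁ / 2 * (X + 1) + K * mnorm ξ ^ p := by
    have key : ∀ y, c₁ * mnorm (ξ + V y) ^ p - ct₁ ≤
        (c₁ / 2 * (mnorm (ξ + V y) ^ p + 1) + K * mnorm ξ ^ p)
          + mdot (S y (ξ + V y)) (V y) := by
      intro y
      have a1 := hco y (ξ + V y)
      rw [mdot_add] at a1
      have a2 := (le_abs_self _).trans (mdot_abs (S y (ξ + V y)) ξ)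
      have a3 := hY _ _ (mnorm_nonneg (S y (ξ + V y))) (mnorm_nonneg ξ)
      have a4 := mul_le_mul_of_nonneg_left (hgr y (ξ + V y))
        (show 0 ≤ c₁ / (2 * c₂) by positivity)
      have a5 : c₁ / (2 * c₂) * (c₂ * (mnorm (ξ + V y) ^ p + 1))
        = c₁ / 2 * (mnorm (ξ + V y) ^ p + 1) := by field_simp
      linarith
    have i2 : Integrable (fun y => c₁ / 2 * (mnorm (ξ + V y) ^ p + 1) + K * mnorm ξ ^ p) μ :=
      ((iw.add (integrable_const 1)).const_mul _).add (integrable_const _)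
    have i1 : Integrable (fun y => c₁ / 2 * (mnorm (ξ + V y) ^ p + 1)) μ :=
      (iw.add (integrable_const 1)).const_mul _
    have := integral_mono ((iw.const_mul c₁).sub (integrable_const ct₁))
      (i2.add isV) key
    simp only [Pi.add_apply, Pi.sub_apply] at this
    rw [integral_sub (iw.const_mul c₁) (integrable_const ct₁),
      integral_add i2 isV, horth,
      integral_add i1 (integrable_const _), integral_const_mul, integral_const_mul,
      integral_add iw (integrable_const 1)] at this
    simpa using this
  -- Jensen
  set A : Matrix (Fin d) (Fin d) ℝ := Matrix.of fun i j => ∫ y, S y (ξ + V y) i j ∂μ with hA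
  have hA1 : mnorm A ≤ ∫ y, mnorm (S y (ξ + V y)) ∂μ := by
    have e : mnorm A ^ 2 = ∫ y, mdot (S y (ξ + V y)) A ∂μ := by
      rw [← mdot_self]
      unfold mdot
      rw [integral_finsetSum Finset.univ (f := fun i y => ∑ j, S y (ξ + V y) i j * A i j)
        fun i _ => integrable_finsetSum _ fun j _ => (isij i j).mul_const _]
      refine Finset.sum_congr rfl fun i _ => ?_
      rw [integral_finsetSum Finset.univ (f := fun j y => S y (ξ + V y) i j * A i j)
        fun j _ => (isij i j).mul_const _]
      refine Finset.sum_congr rfl fun j _ => ?_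
      rw [integral_mul_const]
      rfl
    have l : mnorm A ^ 2 ≤ (∫ y, mnorm (S y (ξ + V y)) ∂μ) * mnorm A := by
      rw [e, ← integral_mul_const]
      exact integral_mono (idot A) (is1.mul_const _)
        fun y => (le_abs_self _).trans (mdot_abs _ _)
    rcases (mnorm_nonneg A).eq_or_lt with h | h
    · rw [← h]; exact integral_nonneg fun y => mnorm_nonneg _
    · rw [sq] at l
      exact le_of_mul_le_mul_right l h
  have hA2 : mnorm A ^ p' ≤ ∫ y, mnorm (S y (ξ + V y)) ^ p' ∂μ := by
    refine (Real.rpow_le_rpow (mnorm_nonneg _) hA1 hp'0.le).trans ?_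
    exact (convexOn_rpow hp'1.le).map_integral_le
      (Real.continuous_rpow_const hp'0.le).continuousOn isClosed_Ici
      (Eventually.of_forall fun y => mnorm_nonneg _) is1 is'
  have hA3 : mnorm A ^ p' ≤ c₂ * (X + 1) := by
    refine hA2.trans ((integral_mono is' ((iw.add (integrable_const 1)).const_mul c₂)
      fun y => hgr y _).trans ?_)
    simp only [Pi.add_apply]
    rw [integral_const_mul, integral_add iw (integrable_const 1)]
    simp [hX]
  refine hA3.trans ?_
  rw [mul_assoc]
  gcongr
  have hx0 : 0 ≤ mnorm ξ ^ p := Real.rpow_nonneg (mnorm_nonneg _) _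
  have hX2 : X ≤ 2 / c₁ * (ct₁ + c₁ / 2 + K * mnorm ξ ^ p) := by
    rw [div_mul_eq_mul_div, le_div_iff₀ hc₁]
    linarith
  have hX3 : 2 / c₁ * (ct₁ + c₁ / 2 + K * mnorm ξ ^ p)
      ≤ 2 / c₁ * ((ct₁ + c₁ / 2 + K) * (mnorm ξ ^ p + 1)) := by
    gcongr
    have : 0 ≤ (ct₁ + c₁ / 2) * mnorm ξ ^ p := by positivity
    nlinarith
  nlinarith
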